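/- For every real number d > 0, the limit lim_{n→∞} s_d(n+1)/s_d(n) exists and equals 2d+1+2√(d²+d), a value that lies strictly between 4d+1 and 4d+2. -/

import Mathlib

open scoped Classical

/-- `s(n,k)`: `s(1,0) = 1`, `s(1,k) = 0` for `k ≥ 1`, and
`s(n,k) = (1/(n-1)) * C(n-1,k) * C(n+k-1,n)` for `n ≥ 2`. -/
noncomputable def schroederS (n k : ℕ) : ℝ :=
  if n = 1 then (if k = 0 then 1 else 0)
  else (1 / ((n : ℝ) - 1)) * ((n - 1).choose k) * ((n + k - 1).choose n)

/-- Weighted small Schröder number `s_d(n) = Σ_{k=0}^{n-1} s(n,k) d^k`. -/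
noncomputable def sd (d : ℝ) (n : ℕ) : ℝ :=
  ∑ k ∈ Finset.range n, schroederS n k * d ^ k

open scoped Nat in
lemma schroederS_eq_factorial (j m : ℕ) :
    schroederS (j + m + 2) (j + 1) =
      ((2 * j + m + 2)! : ℝ) / ((j + m + 2) * (j + m + 1) * (j + 1)! * j ! * m !) := by
  have h₁ : j + m + 2 - 1 = (j + 1) + m := by omega
  have h₂ : j + m + 2 + (j + 1) - 1 = (j + m + 2) + j := by omega
  have h₃ : 2 * j + m + 2 = (j + m + 2) + j := by omega
  have h₄ : (((j + m + 2)! : ℕ) : ℝ) = (j + m + 2) * ((j + 1 + m)! : ℕ) := by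
    rw [show j + m + 2 = (j + 1 + m) + 1 by omega, Nat.factorial_succ]
    push_cast
    ring
  have h₅ : (j : ℝ) + m + 2 - 1 = j + m + 1 := by ring
  rw [schroederS, if_neg (by omega), h₁, h₂, h₃, Nat.cast_add_choose, Nat.cast_add_choose, h₄]
  push_cast
  rw [h₅]
  have := Nat.factorial_ne_zero
  field_simp

lemma schroederS_zero_right (n : ℕ) : schroederS (n + 2) 0 = 0 := by
  simp [schroederS]

lemma schroederS_one_right (n : ℕ) : schroederS (n + 2) 1 = 1 := by
  have h : (n : ℝ) + 2 - 1 ≠ 0 := by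
    have : (0 : ℝ) ≤ n := n.cast_nonneg
    linarith
  simp [schroederS]
  field_simp
  ring

lemma schroederS_eq_zero (n k : ℕ) (h : n + 2 ≤ k) : schroederS (n + 2) k = 0 := by
  simp [schroederS, Nat.choose_eq_zero_of_lt (show n + 1 < k by omega)]

lemma schroederS_recurrence (p k : ℕ) (hk : k < p + 3) :
    ((p : ℝ) + 4) * schroederS (p + 4) (k + 1) =
      (2 * p + 5) * (schroederS (p + 3) (k + 1) + 2 * schroederS (p + 3) k)
        - (p + 1) * schroederS (p + 2) (k + 1) := by
  rcases k with _ | j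
  · rw [schroederS_one_right (p + 2), schroederS_one_right (p + 1), schroederS_one_right,
      schroederS_zero_right (p + 1)]
    ring
  rcases (show j = p + 1 ∨ j = p ∨ j + 1 ≤ p by omega) with rfl | rfl | h
  · rw [schroederS_eq_zero p _ (by omega), schroederS_eq_zero (p + 1) _ (by omega)]
    have h₁ := schroederS_eq_factorial (p + 2) 0
    have h₂ := schroederS_eq_factorial (p + 1) 0
    simp only [add_zero] at h₁ h₂
    rw [h₁, h₂, show 2 * (p + 2) + 2 = 2 * p + 4 + 1 + 1 by ring,
      show 2 * (p + 1) + 2 = 2 * p + 4 by ring]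
    simp only [Nat.factorial_succ]
    push_cast
    have := Nat.factorial_ne_zero
    field_simp
    ring
  · rw [schroederS_eq_zero j _ (by omega)]
    have h₁ := schroederS_eq_factorial (j + 1) 1
    have h₂ := schroederS_eq_factorial (j + 1) 0
    have h₃ := schroederS_eq_factorial j 1
    simp only [add_zero] at h₁ h₂ h₃
    rw [show j + 4 = j + 1 + 1 + 2 by ring, h₁, h₂, show j + 3 = j + 1 + 2 by ring, h₃,
      show 2 * (j + 1) + 1 + 2 = 2 * j + 3 + 1 + 1 by ring,
      show 2 * (j + 1) + 2 = 2 * j + 3 + 1 by ring,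
      show 2 * j + 1 + 2 = 2 * j + 3 by ring]
    simp only [Nat.factorial_succ]
    push_cast
    have := Nat.factorial_ne_zero
    field_simp
    ring
  · obtain ⟨m, rfl⟩ := Nat.exists_eq_add_of_le h
    have h₁ := schroederS_eq_factorial (j + 1) (m + 2)
    have h₂ := schroederS_eq_factorial (j + 1) (m + 1)
    have h₃ := schroederS_eq_factorial j (m + 2)
    have h₄ := schroederS_eq_factorial (j + 1) m
    rw [show j + 1 + m + 4 = j + 1 + (m + 2) + 2 by ring, h₁, h₄,
      show j + 1 + m + 3 = j + 1 + (m + 1) + 2 by ring, h₂,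
      show j + 1 + (m + 1) + 2 = j + (m + 2) + 2 by ring, h₃,
      show 2 * (j + 1) + (m + 2) + 2 = 2 * j + m + 4 + 1 + 1 by ring,
      show 2 * (j + 1) + (m + 1) + 2 = 2 * j + m + 4 + 1 by ring,
      show 2 * j + (m + 2) + 2 = 2 * j + m + 4 by ring,
      show 2 * (j + 1) + m + 2 = 2 * j + m + 4 by ring]
    simp only [Nat.factorial_succ (2 * j + m + 4), Nat.factorial_succ (2 * j + m + 4 + 1),
      Nat.factorial_succ j, Nat.factorial_succ (j + 1), Nat.factorial_succ m,
      Nat.factorial_succ (m + 1)]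
    push_cast
    have := Nat.factorial_ne_zero
    field_simp
    ring

lemma sd_eq_sum_succ (d : ℝ) (n N : ℕ) (h : n + 1 ≤ N) :
    sd d (n + 2) = ∑ k ∈ Finset.range N, schroederS (n + 2) (k + 1) * d ^ (k + 1) := by
  have h₁ : sd d (n + 2) = ∑ k ∈ Finset.range (N + 1), schroederS (n + 2) k * d ^ k := by
    refine Finset.sum_subset (by simpa using h) fun k _ hk => ?_
    rw [schroederS_eq_zero n k (by simpa using hk), zero_mul]
  rw [h₁, Finset.sum_range_succ', schroederS_zero_right, zero_mul, add_zero]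

lemma sd_recurrence (d : ℝ) (p : ℕ) :
    ((p : ℝ) + 4) * sd d (p + 4) =
      (2 * p + 5) * (2 * d + 1) * sd d (p + 3) - (p + 1) * sd d (p + 2) := by
  have h : (2 * d + 1) * sd d (p + 3) = ∑ k ∈ Finset.range (p + 3),
      (schroederS (p + 3) (k + 1) + 2 * schroederS (p + 3) k) * d ^ (k + 1) := by
    rw [add_mul, one_mul]
    nth_rw 2 [sd_eq_sum_succ d (p + 1) (p + 3) (by omega)]
    rw [sd, Finset.mul_sum, ← Finset.sum_add_distrib]
    exact Finset.sum_congr rfl fun k _ => by ring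
  rw [mul_assoc, h, sd_eq_sum_succ d (p + 2) (p + 3) (by omega),
    sd_eq_sum_succ d p (p + 3) (by omega), Finset.mul_sum, Finset.mul_sum, Finset.mul_sum,
    ← Finset.sum_sub_distrib]
  refine Finset.sum_congr rfl fun k hk => ?_
  rw [← mul_assoc, schroederS_recurrence p k (Finset.mem_range.mp hk)]
  ring

lemma sd_pos_and_le_succ {d : ℝ} (hd : 0 < d) (p : ℕ) :
    0 < sd d (p + 2) ∧ sd d (p + 2) ≤ sd d (p + 3) := by
  induction p with
  | zero =>
    have h₂ : sd d 2 = d := by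
      simp [sd, Finset.sum_range_succ, schroederS]
      norm_num
    have h₃ : sd d 3 = d + 2 * d ^ 2 := by
      simp [sd, Finset.sum_range_succ, schroederS, Nat.choose]
      norm_num
    simp only [zero_add, h₂, h₃]
    exact ⟨hd, by nlinarith⟩
  | succ p ih =>
    have h := sd_recurrence d p
    have hp : (0 : ℝ) ≤ p := p.cast_nonneg
    have hpos : 0 < sd d (p + 3) := ih.1.trans_le ih.2
    refine ⟨hpos, le_of_mul_le_mul_left (a := (p : ℝ) + 4) ?_ (by positivity)⟩
    change ((p : ℝ) + 4) * sd d (p + 3) ≤ (p + 4) * sd d (p + 4)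
    have h₁ : 0 ≤ (2 * (p : ℝ) + 5) * (2 * d) * sd d (p + 3) := by positivity
    have h₂ := mul_le_mul_of_nonneg_left ih.2 (show (0 : ℝ) ≤ p + 1 by positivity)
    rw [h]
    linarith

open Filter Topology in
lemma tendsto_zero_of_le_mul_add {u e : ℕ → ℝ} {q : ℝ} (hu : ∀ n, 0 ≤ u n) (hq₀ : 0 ≤ q)
    (hq₁ : q < 1) (he : Tendsto e atTop (𝓝 0)) (h : ∀ n, u (n + 1) ≤ q * u n + e n) :
    Tendsto u atTop (𝓝 0) := by
  rw [Metric.tendsto_atTop]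
  intro ε hε
  have hc : 0 < (1 - q) * (ε / 2) := mul_pos (by linarith) (by linarith)
  obtain ⟨N, hN⟩ := eventually_atTop.mp (he.eventually (gt_mem_nhds hc))
  have hbound : ∀ k, u (N + k) ≤ q ^ k * u N + ε / 2 := by
    intro k
    induction k with
    | zero => simpa using (half_pos hε).le
    | succ k ih =>
      have h₁ := h (N + k)
      have h₂ := hN (N + k) (by omega)
      have h₃ := mul_le_mul_of_nonneg_left ih hq₀
      rw [← add_assoc, pow_succ]
      linarith
  have hpow : Tendsto (fun k => q ^ k * u N) atTop (𝓝 0) := by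
    simpa using (tendsto_pow_atTop_nhds_zero_of_lt_one hq₀ hq₁).mul_const (u N)
  obtain ⟨K, hK⟩ := eventually_atTop.mp (hpow.eventually (gt_mem_nhds (half_pos hε)))
  refine ⟨N + K, fun n hn => ?_⟩
  obtain ⟨k, rfl⟩ := Nat.exists_eq_add_of_le (show N ≤ n by omega)
  rw [Real.dist_0_eq_abs, abs_of_nonneg (hu _)]
  linarith [hbound k, hK k (by omega)]

open Filter Topology in
lemma tendsto_of_eq_sub_div {r a b : ℕ → ℝ} {c μ : ℝ} (hr : ∀ n, 1 ≤ r n) (hμ : 1 < μ)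
    (hc : μ = c - 1 / μ) (ha : Tendsto a atTop (𝓝 c)) (hb : Tendsto b atTop (𝓝 1))
    (h : ∀ n, r (n + 1) = a n - b n / r n) : Tendsto r atTop (𝓝 μ) := by
  rw [tendsto_iff_dist_tendsto_zero]
  refine tendsto_zero_of_le_mul_add (q := 1 / μ) (e := fun n => |a n - c| + |1 - b n|)
    (fun _ => dist_nonneg) (by positivity) ((div_lt_one (by linarith)).mpr hμ) ?_ fun n => ?_
  · have h₁ : Tendsto (fun n => |a n - c|) atTop (𝓝 0) := by
      simpa using (ha.sub_const c).abs
    have h₂ : Tendsto (fun n => |1 - b n|) atTop (𝓝 0) := by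
      simpa using (hb.const_sub 1).abs
    simpa using h₁.add h₂
  · have hrn : 0 < r n := by linarith [hr n]
    have hμ₀ : 0 < μ := by linarith
    have hinv : (r n)⁻¹ ≤ 1 := inv_le_one_of_one_le₀ (hr n)
    have hinv₀ : 0 < (r n)⁻¹ := inv_pos.mpr hrn
    have key : r (n + 1) - μ =
        1 / μ * (r n - μ) * (r n)⁻¹ + ((a n - c) + (1 - b n) * (r n)⁻¹) := by
      have : 1 / μ * (r n - μ) * (r n)⁻¹ = 1 / μ - (r n)⁻¹ := by
        field_simp
      rw [this, h n]
      nth_rw 1 [hc]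
      rw [div_eq_mul_inv (b n)]
      ring
    simp only [Real.dist_eq]
    rw [key]
    refine (abs_add_le _ _).trans (add_le_add ?_ ((abs_add_le _ _).trans (add_le_add le_rfl ?_)))
    · rw [abs_mul, abs_mul, abs_of_pos hinv₀, abs_of_pos (show 0 < 1 / μ by positivity)]
      exact mul_le_of_le_one_right (by positivity) hinv
    · rw [abs_mul, abs_of_pos hinv₀]
      exact mul_le_of_le_one_right (abs_nonneg _) hinv

open Filter Topology in
lemma tendsto_linear_div_linear (α β γ : ℝ) :
    Tendsto (fun p : ℕ => (α * p + β) / ((p : ℝ) + γ)) atTop (𝓝 α) := by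
  have h : Tendsto (fun p : ℕ => (p : ℝ) + γ) atTop atTop :=
    tendsto_atTop_add_const_right _ _ tendsto_natCast_atTop_atTop
  have h₁ : Tendsto (fun p : ℕ => α + (β - α * γ) / ((p : ℝ) + γ)) atTop (𝓝 α) := by
    simpa using (h.const_div_atTop (β - α * γ)).const_add α
  refine h₁.congr' ?_
  filter_upwards [h.eventually_gt_atTop 0] with p hp
  field_simp
  ring

/-- For `d > 0`, `lim_{n→∞} s_d(n+1)/s_d(n) = 2d+1+2√(d²+d)`, which lies strictly
between `4d+1` and `4d+2`. -/
theorem weighted_schroeder_growth_rate (d : ℝ) (hd : 0 < d) :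
    Filter.Tendsto (fun n : ℕ => sd d (n + 1) / sd d n) Filter.atTop
        (nhds (2 * d + 1 + 2 * Real.sqrt (d ^ 2 + d))) ∧
      4 * d + 1 < 2 * d + 1 + 2 * Real.sqrt (d ^ 2 + d) ∧
      2 * d + 1 + 2 * Real.sqrt (d ^ 2 + d) < 4 * d + 2 := by
  have hlow : d < √(d ^ 2 + d) := Real.lt_sqrt_of_sq_lt (by linarith)
  have hhigh : √(d ^ 2 + d) < d + 1 / 2 :=
    (Real.sqrt_lt' (by positivity)).mpr (by nlinarith)
  refine ⟨?_, by linarith, by linarith⟩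
  rw [← Filter.tendsto_add_atTop_iff_nat 2]
  have hsq : √(d ^ 2 + d) ^ 2 = d ^ 2 + d := Real.sq_sqrt (by positivity)
  have hμ : 0 < 2 * d + 1 + 2 * √(d ^ 2 + d) := by positivity
  refine tendsto_of_eq_sub_div (c := 2 * (2 * d + 1))
    (a := fun p => (2 * (2 * d + 1) * p + 5 * (2 * d + 1)) / ((p : ℝ) + 4))
    (b := fun p => (1 * p + 1) / ((p : ℝ) + 4))
    (fun p => (one_le_div (sd_pos_and_le_succ hd p).1).mpr (sd_pos_and_le_succ hd p).2)
    (by linarith) ?_ (tendsto_linear_div_linear _ _ _) (tendsto_linear_div_linear _ _ _)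
    fun p => ?_
  · rw [eq_sub_iff_add_eq, ← eq_sub_iff_add_eq', div_eq_iff hμ.ne']
    linear_combination 4 * hsq
  · have h₂ := (sd_pos_and_le_succ hd p).1
    have h₃ : 0 < sd d (p + 3) := h₂.trans_le (sd_pos_and_le_succ hd p).2
    change sd d (p + 4) / sd d (p + 3) = _ - _ / (sd d (p + 3) / sd d (p + 2))
    have h₄ : (p : ℝ) + 4 ≠ 0 := by positivity
    field_simp
    linear_combination sd_recurrence d p
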